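/- Let N be a positive integer, 0 < s < 1 with N > 2s, α > -2s and 1 < p < (N + 2α + 2s)/(N - 2s). Let u be an admissible positive solution of the Hénon equation. Then there exists λ₀ > 0 such that for every 0 < λ < λ₀ and every x with 0 < |x| < λ one has u_λ(x) ≥ u(x). -/

import Mathlib

open MeasureTheory Filter Set

/-- The principal-value fractional Laplacian: `IsFracLapAt N s u x L` means that
`lim_{ε→0⁺} ∫_{|y-x|>ε} (u(x)-u(y))/|x-y|^{N+2s} dy` exists and equals `L`. -/
def IsFracLapAt (N : ℕ) (s : ℝ) (u : EuclideanSpace ℝ (Fin N) → ℝ)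
    (x : EuclideanSpace ℝ (Fin N)) (L : ℝ) : Prop :=
  Filter.Tendsto (fun ε : ℝ =>
      ∫ y in {y : EuclideanSpace ℝ (Fin N) | ε < ‖y - x‖},
        (u x - u y) / ‖x - y‖ ^ ((N : ℝ) + 2 * s))
    (nhdsWithin 0 (Set.Ioi 0)) (nhds L)

/-- The Kelvin transform `u_λ(x) = (λ/|x|)^{N-2s} u(λ²x/|x|²)`. -/
noncomputable def kelvinTransform (N : ℕ) (s lam : ℝ)
    (u : EuclideanSpace ℝ (Fin N) → ℝ) (x : EuclideanSpace ℝ (Fin N)) : ℝ :=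
  (lam / ‖x‖) ^ ((N : ℝ) - 2 * s) * u ((lam ^ 2 / ‖x‖ ^ 2) • x)

/-- `u` is `C^{1,1}` on a neighbourhood of `x`. -/
def C11Near (N : ℕ) (u : EuclideanSpace ℝ (Fin N) → ℝ)
    (x : EuclideanSpace ℝ (Fin N)) : Prop :=
  ∃ ε > 0, ContDiffOn ℝ 1 u (Metric.ball x ε) ∧
    ∃ K : NNReal, LipschitzOnWith K (fderiv ℝ u) (Metric.ball x ε)

/-- `u` is an admissible positive solution of the Hénon equation
`(-Δ)^s u = |x|^α u^p`: it is positive, continuous, locally bounded, lies in `L_{2s}`,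
is `C^{1,1}` near every point of `ℝ^N \ {0}`, solves the equation pointwise away from
the origin and satisfies the equivalent integral equation. -/
def AdmissiblePositiveSolution (N : ℕ) (s α p : ℝ)
    (u : EuclideanSpace ℝ (Fin N) → ℝ) : Prop :=
  Continuous u ∧ (∀ x, 0 < u x) ∧
  (∀ R : ℝ, ∃ C : ℝ, ∀ x : EuclideanSpace ℝ (Fin N), ‖x‖ ≤ R → u x ≤ C) ∧
  Integrable (fun y : EuclideanSpace ℝ (Fin N) =>
    |u y| / (1 + ‖y‖ ^ ((N : ℝ) + 2 * s))) ∧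
  (∀ x : EuclideanSpace ℝ (Fin N), x ≠ 0 → C11Near N u x) ∧
  (∀ x : EuclideanSpace ℝ (Fin N), x ≠ 0 →
    ∃ L : ℝ, IsFracLapAt N s u x L ∧ L = ‖x‖ ^ α * u x ^ p) ∧
  (∀ x : EuclideanSpace ℝ (Fin N),
    Integrable (fun y : EuclideanSpace ℝ (Fin N) =>
      ‖y‖ ^ α * u y ^ p / ‖x - y‖ ^ ((N : ℝ) - 2 * s)) ∧
    u x = ∫ y : EuclideanSpace ℝ (Fin N),
      ‖y‖ ^ α * u y ^ p / ‖x - y‖ ^ ((N : ℝ) - 2 * s))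

lemma abs_det_fderiv_inversion_zero {N : ℕ} (lam : ℝ) (z : EuclideanSpace ℝ (Fin N)) :
    |((lam / dist z 0) ^ 2 • ((Submodule.span ℝ {z - 0})ᗮ.reflection :
      EuclideanSpace ℝ (Fin N) →L[ℝ] EuclideanSpace ℝ (Fin N))).det|
      = ((lam / ‖z‖) ^ 2) ^ N := by
  have h : |LinearMap.det ((Submodule.span ℝ {z - 0})ᗮ.reflection.toLinearMap)| = 1 := by
    rw [Submodule.det_reflection, abs_pow, abs_neg, abs_one, one_pow]
  have h' : ((lam / dist z 0) ^ 2 • ((Submodule.span ℝ {z - 0})ᗮ.reflection :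
      EuclideanSpace ℝ (Fin N) →L[ℝ] EuclideanSpace ℝ (Fin N))).det
      = ((lam / ‖z‖) ^ 2) ^ N *
        LinearMap.det ((Submodule.span ℝ {z - 0})ᗮ.reflection.toLinearMap) := by
    rw [ContinuousLinearMap.det, ContinuousLinearMap.toLinearMap_smul, LinearMap.det_smul,
      finrank_euclideanSpace_fin, dist_zero_right]
    rfl
  rw [h', abs_mul, h, mul_one, abs_of_nonneg (by positivity)]

lemma inversion_zero_image_punctured_ball {N : ℕ} {lam : ℝ} (hlam : 0 < lam) :
    EuclideanGeometry.inversion (0 : EuclideanSpace ℝ (Fin N)) lam ''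
      (Metric.ball 0 lam \ {0}) = (Metric.closedBall 0 lam)ᶜ := by
  have hI := EuclideanGeometry.inversion_involutive (0 : EuclideanSpace ℝ (Fin N)) hlam.ne'
  rw [hI.image_eq_preimage_symm]
  ext y
  have hd := EuclideanGeometry.dist_inversion_center (0 : EuclideanSpace ℝ (Fin N)) y lam
  simp only [mem_preimage, Set.mem_sdiff, Metric.mem_ball, mem_singleton_iff, mem_compl_iff,
    Metric.mem_closedBall, not_le, hd, EuclideanGeometry.inversion_eq_center hlam.ne']
  constructor
  · rintro ⟨h1, h2⟩
    have h3 : 0 < dist y 0 := dist_pos.2 h2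
    rw [div_lt_iff₀ h3] at h1
    nlinarith
  · intro h
    have h3 : 0 < dist y 0 := hlam.trans h
    refine ⟨?_, dist_pos.1 h3⟩
    rw [div_lt_iff₀ h3]
    nlinarith

/-- The Jacobian of the inversion times the transformed Riesz kernel. -/
lemma jacobian_mul_riesz_inversion {N : ℕ} {lam γ : ℝ} (hlam : 0 < lam)
    {x z : EuclideanSpace ℝ (Fin N)} (hx : x ≠ 0) (hz : z ≠ 0) (c : ℝ) :
    ((lam / ‖z‖) ^ 2) ^ N *
        (c / ‖x - EuclideanGeometry.inversion 0 lam z‖ ^ γ)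
      = (lam / ‖x‖) ^ γ * ((lam / ‖z‖) ^ (2 * (N : ℝ) - γ) * c /
          ‖EuclideanGeometry.inversion 0 lam x - z‖ ^ γ) := by
  have hx' : 0 < ‖x‖ := norm_pos_iff.2 hx
  have hz' : 0 < ‖z‖ := norm_pos_iff.2 hz
  have hIx : EuclideanGeometry.inversion 0 lam x ≠ 0 :=
    (EuclideanGeometry.inversion_eq_center hlam.ne').not.2 hx
  have hd := EuclideanGeometry.dist_inversion_inversion hIx hz lam
  rw [EuclideanGeometry.inversion_inversion _ hlam.ne', EuclideanGeometry.dist_inversion_center,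
    dist_zero_right, dist_zero_right, dist_eq_norm, dist_eq_norm] at hd
  have hd' : ‖x - EuclideanGeometry.inversion 0 lam z‖ =
      (lam / ‖z‖) / (lam / ‖x‖) * ‖EuclideanGeometry.inversion 0 lam x - z‖ := by
    rw [hd]; field_simp
  have hpow : ((lam / ‖z‖) ^ 2) ^ N = (lam / ‖z‖) ^ (2 * (N : ℝ)) := by
    rw [← pow_mul, ← Real.rpow_natCast]; push_cast; rfl
  have ha : 0 < (lam / ‖z‖) ^ γ := by positivity
  have hb : 0 < (lam / ‖x‖) ^ γ := by positivity
  rw [hd', hpow, Real.mul_rpow (by positivity) (norm_nonneg _),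
    Real.div_rpow (x := lam / ‖z‖) (y := lam / ‖x‖) (by positivity) (by positivity),
    Real.rpow_sub (by positivity)]
  generalize (lam / ‖z‖) ^ γ = a at ha ⊢
  generalize (lam / ‖x‖) ^ γ = b at hb ⊢
  generalize ‖EuclideanGeometry.inversion 0 lam x - z‖ ^ γ = D
  rcases eq_or_ne D 0 with rfl | hD
  · simp
  · field_simp

/-- Riesz potentials over the exterior of a ball, pulled back to the ball by inversion. -/
lemma riesz_exterior_inversion {N : ℕ} {lam γ : ℝ} (hlam : 0 < lam)
    (f : EuclideanSpace ℝ (Fin N) → ℝ) {x : EuclideanSpace ℝ (Fin N)} (hx : x ≠ 0)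
    (hf : Integrable (fun y => f y / ‖x - y‖ ^ γ)) :
    IntegrableOn (fun z => (lam / ‖z‖) ^ (2 * (N : ℝ) - γ) *
        f (EuclideanGeometry.inversion 0 lam z) /
          ‖EuclideanGeometry.inversion 0 lam x - z‖ ^ γ) (Metric.ball 0 lam \ {0}) ∧
    ∫ y in (Metric.closedBall 0 lam)ᶜ, f y / ‖x - y‖ ^ γ
      = (lam / ‖x‖) ^ γ * ∫ z in Metric.ball 0 lam \ {0},
        (lam / ‖z‖) ^ (2 * (N : ℝ) - γ) * f (EuclideanGeometry.inversion 0 lam z) /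
          ‖EuclideanGeometry.inversion 0 lam x - z‖ ^ γ := by
  have hms : MeasurableSet (Metric.ball (0 : EuclideanSpace ℝ (Fin N)) lam \ {0}) :=
    measurableSet_ball.diff (measurableSet_singleton _)
  have hder : ∀ z ∈ Metric.ball (0 : EuclideanSpace ℝ (Fin N)) lam \ {0},
      HasFDerivWithinAt (EuclideanGeometry.inversion 0 lam)
        ((lam / dist z 0) ^ 2 • ((Submodule.span ℝ {z - 0})ᗮ.reflection :
          EuclideanSpace ℝ (Fin N) →L[ℝ] EuclideanSpace ℝ (Fin N)))
        (Metric.ball 0 lam \ {0}) z :=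
    fun z hz => (EuclideanGeometry.hasFDerivAt_inversion (R := lam) hz.2).hasFDerivWithinAt
  have hinj := (EuclideanGeometry.inversion_injective
    (0 : EuclideanSpace ℝ (Fin N)) hlam.ne').injOn (s := Metric.ball 0 lam \ {0})
  have hcongr : EqOn (fun z => |((lam / dist z 0) ^ 2 •
        ((Submodule.span ℝ {z - 0})ᗮ.reflection :
          EuclideanSpace ℝ (Fin N) →L[ℝ] EuclideanSpace ℝ (Fin N))).det| •
        (f (EuclideanGeometry.inversion 0 lam z) /
          ‖x - EuclideanGeometry.inversion 0 lam z‖ ^ γ))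
      (fun z => (lam / ‖x‖) ^ γ * ((lam / ‖z‖) ^ (2 * (N : ℝ) - γ) *
        f (EuclideanGeometry.inversion 0 lam z) /
          ‖EuclideanGeometry.inversion 0 lam x - z‖ ^ γ)) (Metric.ball 0 lam \ {0}) := by
    intro z hz
    simp only [abs_det_fderiv_inversion_zero, smul_eq_mul]
    exact jacobian_mul_riesz_inversion hlam hx hz.2 _
  have hc : (lam / ‖x‖) ^ γ ≠ 0 := by
    have := norm_pos_iff.2 hx
    positivity
  constructor
  · have h := hf.integrableOn (s := (Metric.closedBall 0 lam)ᶜ)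
    rw [← inversion_zero_image_punctured_ball hlam,
      integrableOn_image_iff_integrableOn_abs_det_fderiv_smul volume hms hder hinj,
      integrableOn_congr_fun hcongr hms] at h
    exact (integrable_const_mul_iff hc.isUnit _).1 h
  · rw [← inversion_zero_image_punctured_ball hlam,
      integral_image_eq_integral_abs_det_fderiv_smul volume hms hder hinj,
      setIntegral_congr_fun hms hcongr, integral_const_mul]

/-- A Riesz potential as an integral over a ball, with the density and its inverted copy. -/
lemma riesz_eq_integral_ball {N : ℕ} (hN : 0 < N) {lam γ : ℝ} (hlam : 0 < lam)
    (f : EuclideanSpace ℝ (Fin N) → ℝ) {x : EuclideanSpace ℝ (Fin N)} (hx : x ≠ 0)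
    (hf : Integrable (fun y => f y / ‖x - y‖ ^ γ)) :
    ∫ y, f y / ‖x - y‖ ^ γ = (∫ z in Metric.ball 0 lam \ {0}, f z / ‖x - z‖ ^ γ) +
      (lam / ‖x‖) ^ γ * ∫ z in Metric.ball 0 lam \ {0},
        (lam / ‖z‖) ^ (2 * (N : ℝ) - γ) * f (EuclideanGeometry.inversion 0 lam z) /
          ‖EuclideanGeometry.inversion 0 lam x - z‖ ^ γ := by
  have : NeZero N := ⟨hN.ne'⟩
  have hdisj : Disjoint (Metric.ball (0 : EuclideanSpace ℝ (Fin N)) lam \ {0})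
      (Metric.closedBall 0 lam)ᶜ :=
    (disjoint_compl_right_iff_subset.2 (sdiff_subset.trans Metric.ball_subset_closedBall))
  have hae : (Metric.ball (0 : EuclideanSpace ℝ (Fin N)) lam \ {0} ∪
      (Metric.closedBall 0 lam)ᶜ : Set _) =ᵐ[volume] (univ : Set (EuclideanSpace ℝ (Fin N))) := by
    rw [ae_eq_univ]
    refine measure_mono_null (t := Metric.sphere 0 lam ∪ {0}) ?_
      (measure_union_null (Measure.addHaar_sphere _ _ _) (measure_singleton _))
    intro y hy
    by_cases h0 : y = 0
    · exact Or.inr h0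
    · left
      simp only [mem_compl_iff, mem_union, Set.mem_sdiff, Metric.mem_ball, mem_singleton_iff, h0,
        not_false_eq_true, and_true, Metric.mem_closedBall, not_or, not_lt, not_not] at hy
      exact le_antisymm hy.2 hy.1
  rw [← (riesz_exterior_inversion hlam f hx hf).2, ← setIntegral_univ,
    ← setIntegral_congr_set hae,
    setIntegral_union hdisj measurableSet_closedBall.compl hf.integrableOn hf.integrableOn]

lemma norm_sub_le_norm_inversion_sub {N : ℕ} {lam : ℝ} (hlam : 0 < lam)
    {x z : EuclideanSpace ℝ (Fin N)} (hx0 : x ≠ 0) (hx : ‖x‖ ≤ lam) (hz : ‖z‖ ≤ lam) :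
    ‖x - z‖ ≤ ‖x‖ / lam * ‖EuclideanGeometry.inversion 0 lam x - z‖ := by
  have hx' : 0 < ‖x‖ := norm_pos_iff.2 hx0
  refine le_of_sq_le_sq ?_ (by positivity)
  have h1 : EuclideanGeometry.inversion 0 lam x = (lam / ‖x‖) ^ 2 • x := by
    simp [EuclideanGeometry.inversion]
  rw [mul_pow, norm_sub_sq_real, norm_sub_sq_real, h1, norm_smul, real_inner_smul_left]
  have h2 : ‖(lam / ‖x‖) ^ 2‖ = (lam / ‖x‖) ^ 2 := by
    rw [Real.norm_of_nonneg]; positivity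
  rw [h2]
  have h3 : (‖x‖ / lam) ^ 2 * (((lam / ‖x‖) ^ 2 * ‖x‖) ^ 2 -
      2 * ((lam / ‖x‖) ^ 2 * inner ℝ x z) + ‖z‖ ^ 2) =
      lam ^ 2 - 2 * inner ℝ x z + ‖x‖ ^ 2 * ‖z‖ ^ 2 / lam ^ 2 := by
    field_simp
  rw [h3]
  have h4 : 0 ≤ (lam ^ 2 - ‖x‖ ^ 2) * (lam ^ 2 - ‖z‖ ^ 2) / lam ^ 2 := by
    have := pow_le_pow_left₀ (norm_nonneg x) hx 2
    have := pow_le_pow_left₀ (norm_nonneg z) hz 2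
    apply div_nonneg (mul_nonneg _ _) (by positivity) <;> linarith
  have h5 : (lam ^ 2 - ‖x‖ ^ 2) * (lam ^ 2 - ‖z‖ ^ 2) / lam ^ 2 =
      lam ^ 2 - ‖x‖ ^ 2 - ‖z‖ ^ 2 + ‖x‖ ^ 2 * ‖z‖ ^ 2 / lam ^ 2 := by
    field_simp; ring
  linarith

/-- The Riesz kernel dominates the kernel reflected in the sphere. -/
lemma reflected_riesz_le {N : ℕ} {lam γ : ℝ} (hlam : 0 < lam) (hγ : 0 ≤ γ)
    {x z : EuclideanSpace ℝ (Fin N)} (hx0 : x ≠ 0) (hx : ‖x‖ ≤ lam) (hz : ‖z‖ ≤ lam)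
    (hxz : z ≠ x) :
    (lam / ‖x‖) ^ γ * (1 / ‖EuclideanGeometry.inversion 0 lam x - z‖ ^ γ)
      ≤ 1 / ‖x - z‖ ^ γ := by
  have hx' : 0 < ‖x‖ := norm_pos_iff.2 hx0
  have h0 : 0 < ‖x - z‖ := norm_pos_iff.2 (sub_ne_zero.2 hxz.symm)
  have h := norm_sub_le_norm_inversion_sub hlam hx0 hx hz
  have e : (lam / ‖x‖) ^ γ * (1 / ‖EuclideanGeometry.inversion 0 lam x - z‖ ^ γ) =
      1 / (‖x‖ / lam * ‖EuclideanGeometry.inversion 0 lam x - z‖) ^ γ := by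
    rw [Real.mul_rpow (by positivity) (norm_nonneg _), ← inv_div ‖x‖ lam,
      Real.inv_rpow (by positivity)]
    field_simp
  rw [e]
  exact one_div_le_one_div_of_le (by positivity) (Real.rpow_le_rpow h0.le h hγ)

/-- If a Riesz potential is continuous at the origin, then its contribution from a small ball is
uniformly small near the origin. -/
lemma exists_radius_riesz_ball_lt {N : ℕ} (hN : 0 < N) {γ : ℝ} (hγ : 0 ≤ γ)
    (f : EuclideanSpace ℝ (Fin N) → ℝ) (hf0 : ∀ y, 0 ≤ f y)
    (hf : ∀ x, Integrable (fun y => f y / ‖x - y‖ ^ γ))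
    (hc : ContinuousAt (fun x => ∫ y, f y / ‖x - y‖ ^ γ) 0) {ε : ℝ} (hε : 0 < ε) :
    ∃ r > 0, ∀ x, ‖x‖ < r → ∫ y in Metric.ball 0 r, f y / ‖x - y‖ ^ γ < ε := by
  have : NeZero N := ⟨hN.ne'⟩
  have hlim : Tendsto (fun n : ℕ => ∫ y in Metric.closedBall 0 (1 / ((n : ℝ) + 1)),
      f y / ‖(0 : EuclideanSpace ℝ (Fin N)) - y‖ ^ γ) atTop (nhds 0) := by
    have hanti : Antitone (fun n : ℕ =>
        Metric.closedBall (0 : EuclideanSpace ℝ (Fin N)) (1 / ((n : ℝ) + 1))) := fun m n hmn =>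
      Metric.closedBall_subset_closedBall
        (one_div_le_one_div_of_le (by positivity) (by exact_mod_cast Nat.succ_le_succ hmn))
    have h := tendsto_setIntegral_of_antitone (fun n => measurableSet_closedBall)
      hanti ⟨0, (hf 0).integrableOn⟩
    have hI : (⋂ n : ℕ, Metric.closedBall (0 : EuclideanSpace ℝ (Fin N))
        (1 / ((n : ℝ) + 1))) = {0} := by
      ext y
      simp only [mem_iInter, mem_closedBall_zero_iff, mem_singleton_iff]
      constructor
      · intro hy
        exact norm_le_zero_iff.1 (ge_of_tendsto' tendsto_one_div_add_atTop_nhds_zero_nat hy)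
      · rintro rfl n
        rw [norm_zero]; positivity
    rw [hI] at h
    simpa using h
  obtain ⟨n, hn⟩ := (hlim.eventually_lt_const hε).exists
  set R : ℝ := 1 / ((n : ℝ) + 1)
  have hRpos : 0 < R := by positivity
  have hout : ContinuousAt (fun x => ∫ y in (Metric.closedBall 0 R)ᶜ, f y / ‖x - y‖ ^ γ)
      (0 : EuclideanSpace ℝ (Fin N)) := by
    refine continuousAt_of_dominated
      (bound := fun y => 2 ^ γ * (f y / ‖(0 : EuclideanSpace ℝ (Fin N)) - y‖ ^ γ))
      (Eventually.of_forall fun x => (hf x).aestronglyMeasurable.restrict) ?_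
      ((hf 0).integrableOn.const_mul _) ?_
    · filter_upwards [Metric.ball_mem_nhds (0 : EuclideanSpace ℝ (Fin N)) (half_pos hRpos)]
        with x hx
      filter_upwards [ae_restrict_mem measurableSet_closedBall.compl] with y hy
      rw [mem_ball_zero_iff] at hx
      rw [mem_compl_iff, mem_closedBall_zero_iff, not_le] at hy
      have h1 : ‖y‖ / 2 ≤ ‖x - y‖ := by
        have := norm_sub_norm_le y x
        rw [norm_sub_rev] at this
        linarith
      have hy0 : 0 < ‖y‖ := hRpos.trans hy
      rw [Real.norm_of_nonneg (div_nonneg (hf0 y) (by positivity)), zero_sub, norm_neg]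
      calc f y / ‖x - y‖ ^ γ ≤ f y / (‖y‖ / 2) ^ γ :=
            div_le_div_of_nonneg_left (hf0 y) (by positivity)
              (Real.rpow_le_rpow (by positivity) h1 hγ)
        _ = 2 ^ γ * (f y / ‖y‖ ^ γ) := by
            rw [Real.div_rpow hy0.le (by norm_num)]; field_simp
    · filter_upwards [ae_restrict_mem measurableSet_closedBall.compl] with y hy
      rw [mem_compl_iff, mem_closedBall_zero_iff, not_le] at hy
      have hy0 : 0 < ‖(0 : EuclideanSpace ℝ (Fin N)) - y‖ := by
        rw [zero_sub, norm_neg]; exact hRpos.trans hy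
      refine continuousAt_const.div ?_ (by positivity)
      exact (continuousAt_id.sub continuousAt_const).norm.rpow_const (Or.inl hy0.ne')
  have hin : ContinuousAt (fun x => ∫ y in Metric.closedBall 0 R, f y / ‖x - y‖ ^ γ)
      (0 : EuclideanSpace ℝ (Fin N)) := by
    refine (hc.sub hout).congr (Eventually.of_forall fun x => ?_)
    change (∫ y, f y / ‖x - y‖ ^ γ) - _ = _
    rw [← integral_add_compl (measurableSet_closedBall (x := 0) (ε := R)) (hf x),
      add_sub_cancel_right]
  obtain ⟨δ, hδ, hball⟩ := Metric.eventually_nhds_iff.1 (hin.eventually_lt_const hn)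
  refine ⟨min δ R, lt_min hδ hRpos, fun x hx => lt_of_le_of_lt ?_
    (hball (y := x) (by rw [dist_zero_right]; exact hx.trans_le (min_le_left _ _)))⟩
  refine setIntegral_mono_set (hf x).integrableOn
    (Eventually.of_forall fun y => div_nonneg (hf0 y) (by positivity)) ?_
  exact (Metric.ball_subset_closedBall.trans
    (Metric.closedBall_subset_closedBall (min_le_right _ _))).eventuallyLE

lemma kelvinTransform_eq_inversion {N : ℕ} (s lam : ℝ) (u : EuclideanSpace ℝ (Fin N) → ℝ)
    (x : EuclideanSpace ℝ (Fin N)) :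
    kelvinTransform N s lam u x = (lam / ‖x‖) ^ ((N : ℝ) - 2 * s) *
      u (EuclideanGeometry.inversion 0 lam x) := by
  simp [kelvinTransform, EuclideanGeometry.inversion, div_pow]

/-- For subcritical exponents the inverted density dominates the density of the Kelvin transform
inside the ball. -/
lemma kelvin_density_le {N : ℕ} {s α p lam : ℝ} (hNs : 2 * s < (N : ℝ))
    (hp2 : p < ((N : ℝ) + 2 * α + 2 * s) / ((N : ℝ) - 2 * s)) (hlam : 0 < lam)
    {u : EuclideanSpace ℝ (Fin N) → ℝ} (hu : ∀ x, 0 < u x)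
    {z : EuclideanSpace ℝ (Fin N)} (hz0 : z ≠ 0) (hz : ‖z‖ ≤ lam) :
    ‖z‖ ^ α * kelvinTransform N s lam u z ^ p ≤
      (lam / ‖z‖) ^ (2 * (N : ℝ) - ((N : ℝ) - 2 * s)) *
        (‖EuclideanGeometry.inversion 0 lam z‖ ^ α *
          u (EuclideanGeometry.inversion 0 lam z) ^ p) := by
  have hz' : 0 < ‖z‖ := norm_pos_iff.2 hz0
  have hq : 1 ≤ lam / ‖z‖ := (one_le_div hz').2 hz
  have hq0 : 0 < lam / ‖z‖ := by positivity
  have hn : ‖EuclideanGeometry.inversion 0 lam z‖ = (lam / ‖z‖) ^ (2 : ℝ) * ‖z‖ := by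
    have := EuclideanGeometry.dist_inversion_center (0 : EuclideanSpace ℝ (Fin N)) z lam
    rw [dist_zero_right, dist_zero_right] at this
    rw [this, Real.rpow_two]; field_simp
  rw [lt_div_iff₀ (by linarith)] at hp2
  rw [kelvinTransform_eq_inversion, hn, Real.mul_rpow (by positivity) (hu _).le,
    Real.mul_rpow (by positivity) hz'.le, ← Real.rpow_mul hq0.le, ← Real.rpow_mul hq0.le]
  have hU : 0 ≤ u (EuclideanGeometry.inversion 0 lam z) ^ p := Real.rpow_nonneg (hu _).le _
  have h : (lam / ‖z‖) ^ (((N : ℝ) - 2 * s) * p) ≤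
      (lam / ‖z‖) ^ (2 * (N : ℝ) - ((N : ℝ) - 2 * s)) * (lam / ‖z‖) ^ (2 * α) := by
    rw [← Real.rpow_add hq0]
    exact Real.rpow_le_rpow_of_exponent_le hq (by linarith)
  have := mul_le_mul_of_nonneg_right h (mul_nonneg (Real.rpow_nonneg hz'.le α) hU)
  nlinarith [this]

/-- One step of the comparison between a solution of the integral equation and its Kelvin
transform: the relative defect is halved. -/
lemma kelvin_defect_halving {N : ℕ} (hN : 0 < N) {s α p lam ε : ℝ}
    (hNs : 2 * s < (N : ℝ)) (hp1 : 1 < p)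
    (hp2 : p < ((N : ℝ) + 2 * α + 2 * s) / ((N : ℝ) - 2 * s)) (hlam : 0 < lam)
    {u : EuclideanSpace ℝ (Fin N) → ℝ} (hu : ∀ x, 0 < u x)
    (hint : ∀ x : EuclideanSpace ℝ (Fin N), Integrable (fun y : EuclideanSpace ℝ (Fin N) =>
      ‖y‖ ^ α * u y ^ p / ‖x - y‖ ^ ((N : ℝ) - 2 * s)))
    (heq : ∀ x : EuclideanSpace ℝ (Fin N), u x = ∫ y : EuclideanSpace ℝ (Fin N),
      ‖y‖ ^ α * u y ^ p / ‖x - y‖ ^ ((N : ℝ) - 2 * s))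
    (hsmall : ∀ x, ‖x‖ < lam → ∫ y in Metric.ball 0 lam,
      ‖y‖ ^ α * u y ^ p / ‖x - y‖ ^ ((N : ℝ) - 2 * s) ≤ ε)
    (hε : ∀ x, ‖x‖ < lam → 2 * p * ε ≤ u x)
    {S : ℝ} (hS0 : 0 ≤ S) (hS1 : S ≤ 1)
    (hS : ∀ z, z ≠ 0 → ‖z‖ < lam → (1 - S) * u z ≤ kelvinTransform N s lam u z)
    {x : EuclideanSpace ℝ (Fin N)} (hx0 : x ≠ 0) (hx : ‖x‖ < lam) :
    (1 - S / 2) * u x ≤ kelvinTransform N s lam u x := by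
  have : NeZero N := ⟨hN.ne'⟩
  set γ : ℝ := (N : ℝ) - 2 * s with hγ
  have hγ0 : 0 < γ := by linarith
  set f : EuclideanSpace ℝ (Fin N) → ℝ := fun y => ‖y‖ ^ α * u y ^ p with hf
  have hf0 : ∀ y, 0 ≤ f y := fun y =>
    mul_nonneg (Real.rpow_nonneg (norm_nonneg _) _) (Real.rpow_nonneg (hu y).le _)
  set Q : EuclideanSpace ℝ (Fin N) → ℝ := fun z => (lam / ‖z‖) ^ (2 * (N : ℝ) - γ) *
    f (EuclideanGeometry.inversion 0 lam z)
  set D : Set (EuclideanSpace ℝ (Fin N)) := Metric.ball 0 lam \ {0}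
  have hDm : MeasurableSet D := measurableSet_ball.diff (measurableSet_singleton _)
  set x' : EuclideanSpace ℝ (Fin N) := EuclideanGeometry.inversion 0 lam x with hx'
  have hx'0 : x' ≠ 0 := (EuclideanGeometry.inversion_eq_center hlam.ne').not.2 hx0
  have hxx : EuclideanGeometry.inversion 0 lam x' = x :=
    EuclideanGeometry.inversion_inversion _ hlam.ne' _
  set k : ℝ := (lam / ‖x‖) ^ γ with hk
  have hxn : 0 < ‖x‖ := norm_pos_iff.2 hx0
  have hk0 : 0 < k := by positivity
  have hkk : k * (lam / ‖x'‖) ^ γ = 1 := by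
    have h := EuclideanGeometry.dist_inversion_center (0 : EuclideanSpace ℝ (Fin N)) x lam
    rw [dist_zero_right, dist_zero_right] at h
    rw [hk, hx', h, ← Real.mul_rpow (by positivity) (by positivity)]
    have : lam / ‖x‖ * (lam / (lam ^ 2 / ‖x‖)) = 1 := by field_simp
    rw [this, Real.one_rpow]
  have hfA : IntegrableOn (fun z => f z / ‖x - z‖ ^ γ) D := (hint x).integrableOn
  have hfB : IntegrableOn (fun z => f z / ‖x' - z‖ ^ γ) D := (hint x').integrableOn
  have hQB : IntegrableOn (fun z => Q z / ‖x' - z‖ ^ γ) D :=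
    (riesz_exterior_inversion hlam f hx0 (hint x)).1
  have hQA : IntegrableOn (fun z => Q z / ‖x - z‖ ^ γ) D := by
    have h := (riesz_exterior_inversion hlam f hx'0 (hint x')).1
    rw [hxx] at h
    exact h
  have hu1 : u x = (∫ z in D, f z / ‖x - z‖ ^ γ) + k * ∫ z in D, Q z / ‖x' - z‖ ^ γ :=
    (heq x).trans (riesz_eq_integral_ball hN hlam f hx0 (hint x))
  have hu2 : u x' = (∫ z in D, f z / ‖x' - z‖ ^ γ) +
      (lam / ‖x'‖) ^ γ * ∫ z in D, Q z / ‖x - z‖ ^ γ := by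
    have h := (heq x').trans (riesz_eq_integral_ball hN hlam f hx'0 (hint x'))
    rw [hxx] at h
    exact h
  have hu3 : kelvinTransform N s lam u x =
      k * (∫ z in D, f z / ‖x' - z‖ ^ γ) + ∫ z in D, Q z / ‖x - z‖ ^ γ := by
    rw [kelvinTransform_eq_inversion, ← hγ, ← hk, ← hx', hu2, mul_add, ← mul_assoc, hkk, one_mul]
  have hpt : ∀ z ∈ D, f z - Q z ≤ p * S * f z := by
    intro z hz
    have hzn : ‖z‖ < lam := mem_ball_zero_iff.1 hz.1
    have h1 := kelvin_density_le hNs hp2 hlam hu hz.2 hzn.le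
    have h2 : (1 + p * -S) * u z ^ p ≤ kelvinTransform N s lam u z ^ p := by
      calc (1 + p * -S) * u z ^ p ≤ (1 + -S) ^ p * u z ^ p :=
            mul_le_mul_of_nonneg_right
              (one_add_mul_self_le_rpow_one_add (by linarith) hp1.le)
              (Real.rpow_nonneg (hu z).le _)
        _ = ((1 - S) * u z) ^ p := by
            rw [Real.mul_rpow (by linarith) (hu z).le, sub_eq_add_neg]
        _ ≤ _ := Real.rpow_le_rpow (mul_nonneg (by linarith) (hu z).le) (hS z hz.2 hzn)
            (by linarith)
    have h3 := mul_le_mul_of_nonneg_left h2 (Real.rpow_nonneg (norm_nonneg z) α)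
    have h4 : (1 + p * -S) * f z ≤ Q z := by
      refine le_trans (le_of_eq ?_) (h3.trans h1)
      simp only [hf]; ring
    linarith
  have hdiff : u x - kelvinTransform N s lam u x ≤ p * S * ∫ z in D, f z / ‖x - z‖ ^ γ := by
    have hlhs : u x - kelvinTransform N s lam u x =
        ∫ z in D, ((f z / ‖x - z‖ ^ γ + k * (Q z / ‖x' - z‖ ^ γ)) -
          (k * (f z / ‖x' - z‖ ^ γ) + Q z / ‖x - z‖ ^ γ)) := by
      refine Eq.trans ?_ (integral_sub (hfA.add (hQB.const_mul k))
        ((hfB.const_mul k).add hQA)).symm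
      simp only [Pi.add_apply]
      rw [integral_add hfA (hQB.const_mul k), integral_add (hfB.const_mul k) hQA,
        integral_const_mul, integral_const_mul, ← hu1, ← hu3]
    rw [hlhs, ← integral_const_mul]
    refine integral_mono_ae ((hfA.add (hQB.const_mul k)).sub ((hfB.const_mul k).add hQA))
      (hfA.const_mul _) ?_
    filter_upwards [ae_restrict_mem hDm, Measure.ae_ne (volume.restrict D) x] with z hz hzx
    have hzn : ‖z‖ < lam := mem_ball_zero_iff.1 hz.1
    have hker := reflected_riesz_le hlam hγ0.le hx0 hx.le hzn.le hzx
    have hB0 : 0 ≤ k * (1 / ‖x' - z‖ ^ γ) := by positivity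
    have h1 := mul_le_mul_of_nonneg_left (hpt z hz) (sub_nonneg.2 hker)
    have h2 := mul_nonneg hB0 (mul_nonneg (mul_nonneg (by linarith : (0 : ℝ) ≤ p) hS0) (hf0 z))
    rw [← hk, ← hx'] at h1
    simp only [div_eq_mul_inv, one_mul] at h1 h2 ⊢
    nlinarith [h1, h2]
  have hDle : ∫ z in D, f z / ‖x - z‖ ^ γ ≤ ε :=
    (setIntegral_mono_set (hint x).integrableOn
      (Eventually.of_forall fun y => div_nonneg (hf0 y) (by positivity))
      (sdiff_subset (s := Metric.ball 0 lam) (t := {0})).eventuallyLE).trans (hsmall x hx)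
  have h1 : p * S * ∫ z in D, f z / ‖x - z‖ ^ γ ≤ p * S * ε :=
    mul_le_mul_of_nonneg_left hDle (mul_nonneg (by linarith) hS0)
  have h2 := mul_le_mul_of_nonneg_left (hε x hx) hS0
  linarith

/-- **Start of the moving spheres method** (Proposition 3.2): for small `λ` the Kelvin
transform dominates the solution inside the ball `B_λ \ {0}`. -/
theorem moving_spheres_start
    (N : ℕ) (hN : 0 < N) (s α p : ℝ) (hs0 : 0 < s) (hs1 : s < 1)
    (hNs : 2 * s < (N : ℝ)) (hα : -2 * s < α) (hp1 : 1 < p)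
    (hp2 : p < ((N : ℝ) + 2 * α + 2 * s) / ((N : ℝ) - 2 * s))
    (u : EuclideanSpace ℝ (Fin N) → ℝ)
    (hu : AdmissiblePositiveSolution N s α p u) :
    ∃ lam0 > 0, ∀ lam : ℝ, 0 < lam → lam < lam0 →
      ∀ x : EuclideanSpace ℝ (Fin N), 0 < ‖x‖ → ‖x‖ < lam →
        u x ≤ kelvinTransform N s lam u x := by
  obtain ⟨hcont, hpos, -, -, -, -, hsol⟩ := hu
  have hint := fun x => (hsol x).1
  have heq := fun x => (hsol x).2
  have hε : 0 < u 0 / 2 / (2 * p) := by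
    have := hpos 0
    positivity
  have hev : ∀ᶠ x in nhds (0 : EuclideanSpace ℝ (Fin N)), u 0 / 2 < u x :=
    hcont.continuousAt.eventually_const_lt (half_lt_self (hpos 0))
  obtain ⟨δ, hδ, hδu⟩ := Metric.eventually_nhds_iff.1 hev
  obtain ⟨r, hr, hrsmall⟩ := exists_radius_riesz_ball_lt hN (γ := (N : ℝ) - 2 * s)
    (by linarith) (fun y => ‖y‖ ^ α * u y ^ p)
    (fun y => mul_nonneg (Real.rpow_nonneg (norm_nonneg _) _) (Real.rpow_nonneg (hpos y).le _))
    hint (hcont.continuousAt.congr (Eventually.of_forall heq)) hε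
  refine ⟨min δ r, lt_min hδ hr, fun lam hlam hlt x hx0 hx => ?_⟩
  have hsmall : ∀ x, ‖x‖ < lam → ∫ y in Metric.ball 0 lam,
      ‖y‖ ^ α * u y ^ p / ‖x - y‖ ^ ((N : ℝ) - 2 * s) ≤ u 0 / 2 / (2 * p) := by
    intro x hx
    refine (setIntegral_mono_set (hint x).integrableOn (Eventually.of_forall fun y => ?_)
      (Metric.ball_subset_ball (hlt.le.trans (min_le_right _ _))).eventuallyLE).trans
      (hrsmall x (hx.trans (hlt.trans_le (min_le_right _ _)))).le
    exact div_nonneg (mul_nonneg (Real.rpow_nonneg (norm_nonneg _) _)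
      (Real.rpow_nonneg (hpos y).le _)) (by positivity)
  have hεu : ∀ x, ‖x‖ < lam → 2 * p * (u 0 / 2 / (2 * p)) ≤ u x := by
    intro x hx
    rw [mul_div_cancel₀ _ (by positivity)]
    exact (hδu (by
      rw [dist_zero_right]; exact hx.trans (hlt.trans_le (min_le_left _ _)))).le
  have hiter : ∀ n : ℕ, ∀ z : EuclideanSpace ℝ (Fin N), z ≠ 0 → ‖z‖ < lam →
      (1 - (1 / 2 : ℝ) ^ n) * u z ≤ kelvinTransform N s lam u z := by
    intro n
    induction n with
    | zero =>
      intro z _ _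
      rw [pow_zero, sub_self, zero_mul]
      exact mul_nonneg (Real.rpow_nonneg (by positivity) _) (hpos _).le
    | succ n ih =>
      intro z hz0 hz
      have h := kelvin_defect_halving hN hNs hp1 hp2 hlam hpos hint heq hsmall hεu
        (S := (1 / 2 : ℝ) ^ n) (by positivity) (pow_le_one₀ (by norm_num) (by norm_num)) ih hz0 hz
      rwa [pow_succ, mul_one_div]
  have hlim : Tendsto (fun n : ℕ => (1 - (1 / 2 : ℝ) ^ n) * u x) atTop (nhds ((1 - 0) * u x)) :=
    (tendsto_const_nhds.sub
      (tendsto_pow_atTop_nhds_zero_of_lt_one (by norm_num) (by norm_num))).mul_const _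
  rw [sub_zero, one_mul] at hlim
  exact le_of_tendsto' hlim fun n => hiter n x (norm_pos_iff.1 hx0) hx
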